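/- Let P = (V, ≤) be a finite poset, let B = Min(P) be its set of minimal elements, and let H be the hypergraph with vertex set V ∖ B whose hyperedges are the inclusion-minimal members of the family {↑x ∖ {x} : x ∈ B}. Let t ≥ 1 be an integer. If H does not have conformality t−1, then P contains the standard example S_t as a suborder. -/

import Mathlib

open Set

/-- If the Sperner hypergraph on `V ∖ Min(P)` whose hyperedges are the inclusion-minimal
members of `{↑x ∖ {x} : x ∈ Min(P)}` is not of conformality `t - 1`, then the finite
poset `P` contains the standard example `S_t` as a suborder. -/
theorem stmt2 {V : Type*} [Fintype V] [PartialOrder V] (t : ℕ) (ht : 1 ≤ t)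
    (B : Set V) (hB : B = {x : V | ∀ y : V, y ≤ x → y = x})
    (F : Set (Set V)) (hF : F = {E : Set V | ∃ x ∈ B, E = {v : V | x ≤ v} \ {x}})
    (edges : Set (Set V)) (hedges : edges = {E ∈ F | ∀ E' ∈ F, E' ⊆ E → E' = E})
    (hconf : ¬ (∀ X : Set V, X ⊆ {v : V | v ∉ B} →
        (∀ Y ⊆ X, Y.ncard ≤ t - 1 → ∃ E ∈ edges, Y ⊆ E) → ∃ E ∈ edges, X ⊆ E)) :
    ∃ a b : Fin t → V,
      Function.Injective a ∧ Function.Injective b ∧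
      (∀ i j, a i ≠ b j) ∧
      (∀ i j, a i < b j ↔ i ≠ j) ∧
      (∀ i j, ¬ b i ≤ a j) ∧
      (∀ i j, i ≠ j → ¬ a i ≤ a j) ∧
      (∀ i j, i ≠ j → ¬ b i ≤ b j) := by
  push Not at hconf
  obtain ⟨X, hXB, hX, hXE⟩ := hconf
  -- a minimal subset of `X` that lies in no hyperedge
  obtain ⟨Z, hZX, hZ⟩ := (Set.toFinite {Y : Set V | Y ⊆ X ∧ ∀ E ∈ edges, ¬ Y ⊆ E}
    ).exists_le_minimal (a := X) ⟨Subset.rfl, hXE⟩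
  have hcard : t ≤ Z.ncard := by
    by_contra! hlt
    obtain ⟨E, hE, hZE⟩ := hX Z hZX (by omega)
    exact hZ.prop.2 E hE hZE
  have hdel : ∀ z ∈ Z, ∃ x ∈ B, ∀ w ∈ Z, x < w ↔ z ≠ w := by
    intro z hz
    have hsub : ∃ E ∈ edges, Z \ {z} ⊆ E := by
      by_contra! hno
      have hle := hZ.le_of_le ⟨sdiff_subset.trans hZX, hno⟩ sdiff_subset
      exact (hle hz).2 rfl
    obtain ⟨E, hE, hZE⟩ := hsub
    have hEF := hE
    rw [hedges] at hEF
    obtain ⟨hEF, -⟩ := hEF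
    rw [hF] at hEF
    obtain ⟨x, hx, rfl⟩ := hEF
    have hlt : ∀ w ∈ Z, z ≠ w → x < w := fun w hw hzw =>
      have hxw := hZE ⟨hw, fun h => hzw h.symm⟩
      lt_of_le_of_ne hxw.1 fun h => hxw.2 h.symm
    refine ⟨x, hx, fun w hw => ⟨?_, hlt w hw⟩⟩
    rintro hxz rfl
    refine hZ.prop.2 _ hE fun v hv => ?_
    have hxv : x < v := by
      by_cases h : z = v
      · exact h ▸ hxz
      · exact hlt v hv h
    exact ⟨hxv.le, hxv.ne'⟩
  obtain ⟨T, hTZ, hT⟩ := Set.exists_subset_card_eq hcard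
  have e : Fin t ≃ T := (Finite.equivFinOfCardEq (by rw [Nat.card_coe_set_eq, hT])).symm
  have hbZ : ∀ i, (e i : V) ∈ Z := fun i => hTZ (e i).2
  have hbB : ∀ i, (e i : V) ∉ B := fun i => hXB (hZX (hbZ i))
  have hbinj : Function.Injective fun i => (e i : V) :=
    Subtype.val_injective.comp e.injective
  choose a haB ha using fun i => hdel (e i) (hbZ i)
  have hab : ∀ i j, a i < e j ↔ i ≠ j := fun i j =>
    (ha i _ (hbZ j)).trans hbinj.ne_iff
  have hmin : ∀ i y, y ≤ a i → y = a i := fun i => by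
    have h := haB i
    rw [hB] at h
    exact h
  have hainj : ∀ i j, a i = a j → i = j := fun i j h => by
    by_contra hij
    exact (hab i i).1 (h ▸ (hab j i).2 (Ne.symm hij)) rfl
  refine ⟨a, fun i => e i, fun i j => hainj i j, hbinj,
    fun i j h => hbB j (mem_of_eq_of_mem h.symm (haB i)), hab,
    fun i j h => hbB i (mem_of_eq_of_mem (hmin j _ h) (haB j)),
    fun i j hij h => hij (hainj i j (hmin j _ h)),
    fun i j hij h => (hab j j).1 (((hab j i).2 hij.symm).trans_le h) rfl⟩
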